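/- The values p₁ = p₂ = 1, q_{4,1} = 1, q_{4,2} = −1, q_{5,1} = q_{5,2} = −1/2 satisfy the three equations Σ_{i=1}^2 p_i² q_{4i} = 0, Σ_{i=1}^2 p_i² ((1/2)q_{4i}² + q_{5i}) = 0, and Σ_{i=1}^2 p_i² ((1/6)q_{4i}³ + q_{4i} q_{5i}) = 0; in particular (taking q_{1i} = q₂ = q_{3i} = 0), the Softmax–Softmax polynomial system of order r = 3 with m = 2 blocks admits a non-trivial solution for every d ≥ 1, so r^SS(2) > 3. -/

import Mathlib

/-!
Softmax–Softmax polynomial system: for every dimension `d ≥ 1`, `r^SS(2) = 4`,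
i.e. 4 is the smallest natural number `r` such that the system of order `r`
with `m = 2` blocks admits no non-trivial solution.
-/

noncomputable section

/-- Multi-index `v ^ α := ∏ j, v j ^ α j`. -/
def mpow {d : ℕ} (v : Fin d → ℝ) (α : Fin d → ℕ) : ℝ := ∏ j, v j ^ α j

/-- Multi-index factorial `α! := ∏ j, (α j)!`. -/
def mfact {d : ℕ} (α : Fin d → ℕ) : ℕ := ∏ j, Nat.factorial (α j)

/-- Multi-index degree `|α| := ∑ j, α j`. -/
def mdeg {d : ℕ} (α : Fin d → ℕ) : ℕ := ∑ j, α j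

/-- A finite box containing every multi-index `α ≤ ρ` (coordinatewise). -/
def mIdxBox {d : ℕ} (ρ : Fin d → ℕ) : Finset (Fin d → ℕ) :=
  Fintype.piFinset fun j => Finset.range (ρ j + 1)

/-- Left-hand side of the Softmax–Softmax polynomial equation indexed by `(ρ₁, ρ₂)`:
`∑ i ∑_{α₁+α₂+α₃=ρ₁, |α₃|+α₄+2α₅=ρ₂} p_i² q_{1i}^{α₁} q₂^{α₂} q_{3i}^{α₃} q_{4i}^{α₄} q_{5i}^{α₅}
  / (α₁! α₂! α₃! α₄! α₅!)`. -/
def ssLHS {m d : ℕ} (p : Fin m → ℝ) (q1 : Fin m → Fin d → ℝ) (q2 : Fin d → ℝ)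
    (q3 : Fin m → Fin d → ℝ) (q4 q5 : Fin m → ℝ) (ρ1 : Fin d → ℕ) (ρ2 : ℕ) : ℝ :=
  ∑ i : Fin m, ∑ α1 ∈ mIdxBox ρ1, ∑ α2 ∈ mIdxBox ρ1, ∑ α3 ∈ mIdxBox ρ1,
    ∑ α4 ∈ Finset.range (ρ2 + 1), ∑ α5 ∈ Finset.range (ρ2 + 1),
      if α1 + α2 + α3 = ρ1 ∧ mdeg α3 + α4 + 2 * α5 = ρ2 then
        (1 / ((mfact α1 : ℝ) * (mfact α2 : ℝ) * (mfact α3 : ℝ) *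
            (Nat.factorial α4 : ℝ) * (Nat.factorial α5 : ℝ))) *
          p i ^ 2 * mpow (q1 i) α1 * mpow q2 α2 * mpow (q3 i) α3 *
          q4 i ^ α4 * q5 i ^ α5
      else 0

/-- The Softmax–Softmax system of order `r` (with `m` blocks, in dimension `d`)
admits a non-trivial solution: all `p_i ≠ 0`, some `q_{4i} ≠ 0`, and every equation
indexed by `(ρ₁, ρ₂)` with `1 ≤ |ρ₁| + ρ₂ ≤ r` holds. -/
def ssHasNontrivial (m d r : ℕ) : Prop :=
  ∃ (p : Fin m → ℝ) (q1 : Fin m → Fin d → ℝ) (q2 : Fin d → ℝ)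
    (q3 : Fin m → Fin d → ℝ) (q4 q5 : Fin m → ℝ),
      (∀ i, p i ≠ 0) ∧ (∃ i, q4 i ≠ 0) ∧
      ∀ (ρ1 : Fin d → ℕ) (ρ2 : ℕ), 1 ≤ mdeg ρ1 + ρ2 → mdeg ρ1 + ρ2 ≤ r →
        ssLHS p q1 q2 q3 q4 q5 ρ1 ρ2 = 0


/-- `r^SS(m)`: the smallest `r` such that the Softmax–Softmax system of order `r`
with `m` blocks (in dimension `d`) admits no non-trivial solution. -/
def rSS (m d : ℕ) : ℕ := sInf {r : ℕ | ¬ ssHasNontrivial m d r}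

lemma ssLHS_zero {m d : ℕ} (p : Fin m → ℝ) (q1 : Fin m → Fin d → ℝ) (q2 : Fin d → ℝ)
    (q3 : Fin m → Fin d → ℝ) (q4 q5 : Fin m → ℝ) (ρ2 : ℕ) :
    ssLHS p q1 q2 q3 q4 q5 0 ρ2 = ∑ i : Fin m,
      ∑ α4 ∈ Finset.range (ρ2 + 1), ∑ α5 ∈ Finset.range (ρ2 + 1),
        if α4 + 2 * α5 = ρ2 then
          (1 / ((Nat.factorial α4 : ℝ) * (Nat.factorial α5 : ℝ))) *
            p i ^ 2 * q4 i ^ α4 * q5 i ^ α5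
        else 0 := by
  have hb : mIdxBox (0 : Fin d → ℕ) = {0} := by
    ext a
    simp [mIdxBox, funext_iff]
  unfold ssLHS
  simp [hb, mdeg, mfact, mpow]

lemma mpow_zero_of_ne {d : ℕ} (α : Fin d → ℕ) (h : α ≠ 0) :
    mpow (0 : Fin d → ℝ) α = 0 := by
  obtain ⟨j, hj⟩ := Function.ne_iff.mp h
  exact Finset.prod_eq_zero (Finset.mem_univ j) (by simpa using hj)

lemma ssLHS_of_ne {m d : ℕ} (p : Fin m → ℝ) (q4 q5 : Fin m → ℝ) (ρ1 : Fin d → ℕ)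
    (h : ρ1 ≠ 0) (ρ2 : ℕ) : ssLHS p 0 0 0 q4 q5 ρ1 ρ2 = 0 := by
  unfold ssLHS
  refine Finset.sum_eq_zero fun i _ => Finset.sum_eq_zero fun α1 _ =>
    Finset.sum_eq_zero fun α2 _ => Finset.sum_eq_zero fun α3 _ =>
    Finset.sum_eq_zero fun α4 _ => Finset.sum_eq_zero fun α5 _ => ?_
  split_ifs with hc
  · by_cases h1 : α1 = 0
    · by_cases h2 : α2 = 0
      · have h3 : α3 ≠ 0 := by
          rintro rfl
          apply h
          rw [← hc.1, h1, h2]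
          simp
        simp [mpow_zero_of_ne α3 h3]
      · simp [mpow_zero_of_ne α2 h2]
    · simp [mpow_zero_of_ne α1 h1]
  · rfl

lemma hasNontrivial_three (d : ℕ) : ssHasNontrivial 2 d 3 := by
  refine ⟨![1, 1], 0, 0, 0, ![1, -1], ![-(1/2), -(1/2)], ?_, ⟨0, by simp⟩, ?_⟩
  · intro i
    fin_cases i <;> simp
  · intro ρ1 ρ2 h1 h2
    by_cases h : ρ1 = 0
    · subst h
      have h0 : mdeg (0 : Fin d → ℕ) = 0 := by simp [mdeg]
      rw [h0] at h1 h2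
      rw [ssLHS_zero]
      have h3 : ρ2 = 1 ∨ ρ2 = 2 ∨ ρ2 = 3 := by omega
      rcases h3 with rfl | rfl | rfl <;>
        simp [Finset.sum_range_succ, Nat.factorial] <;> norm_num
    · exact ssLHS_of_ne _ _ _ _ h _

lemma alg_four (a b x y u v : ℝ) (ha : 0 < a) (hb : 0 < b)
    (e1 : a * x + b * y = 0)
    (e2 : a * (x ^ 2 / 2 + u) + b * (y ^ 2 / 2 + v) = 0)
    (e3 : a * (x ^ 3 / 6 + x * u) + b * (y ^ 3 / 6 + y * v) = 0)
    (e4 : a * (x ^ 4 / 24 + x ^ 2 * u / 2 + u ^ 2 / 2)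
      + b * (y ^ 4 / 24 + y ^ 2 * v / 2 + v ^ 2 / 2) = 0) : x = 0 := by
  by_contra hx
  obtain ⟨t, ht⟩ : ∃ t, t = a / b := ⟨_, rfl⟩
  have htp : 0 < t := by rw [ht]; positivity
  have hat : a = t * b := by rw [ht]; field_simp
  subst hat
  have hb' : b ≠ 0 := hb.ne'
  have hy : y = -(t * x) := by
    apply mul_left_cancel₀ hb'
    linarith
  subst hy
  have hv : v = u + x ^ 2 / 6 - t ^ 2 * x ^ 2 / 6 := by
    have hne : b * t * x ≠ 0 := by positivity
    apply mul_left_cancel₀ hne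
    linear_combination -e3
  subst hv
  have hu : u = -(x ^ 2 * (1 + 2 * t) / 6) := by
    have hne : b * (1 + t) ≠ 0 := by positivity
    apply mul_left_cancel₀ hne
    linear_combination e2
  subst hu
  have hne : b * t * x ^ 4 * (1 + t) * (1 + t + t ^ 2) ≠ 0 := by positivity
  apply hne
  linear_combination (-36) * e4

lemma not_hasNontrivial_four (d : ℕ) : ¬ ssHasNontrivial 2 d 4 := by
  rintro ⟨p, q1, q2, q3, q4, q5, hp, ⟨i, hi⟩, h⟩
  have h0 : mdeg (0 : Fin d → ℕ) = 0 := by simp [mdeg]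
  have e1 := h 0 1 (by omega) (by omega)
  have e2 := h 0 2 (by omega) (by omega)
  have e3 := h 0 3 (by omega) (by omega)
  have e4 := h 0 4 (by omega) (by omega)
  rw [ssLHS_zero] at e1 e2 e3 e4
  simp [Finset.sum_range_succ, Nat.factorial] at e1 e2 e3 e4
  have ha : 0 < p 0 ^ 2 := by have := hp 0; positivity
  have hb : 0 < p 1 ^ 2 := by have := hp 1; positivity
  have hx : q4 0 = 0 := by
    apply alg_four (p 0 ^ 2) (p 1 ^ 2) (q4 0) (q4 1) (q5 0) (q5 1) ha hb
    · linear_combination e1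
    · linear_combination e2
    · linear_combination e3
    · linear_combination e4
  have hy : q4 1 = 0 := by
    rw [hx] at e1
    simpa [hp 1] using e1
  fin_cases i
  · exact hi hx
  · exact hi hy

lemma ssHasNontrivial_mono {m d r s : ℕ} (hrs : r ≤ s) (h : ssHasNontrivial m d s) :
    ssHasNontrivial m d r := by
  obtain ⟨p, q1, q2, q3, q4, q5, hp, hq, h⟩ := h
  exact ⟨p, q1, q2, q3, q4, q5, hp, hq, fun ρ1 ρ2 a b => h ρ1 ρ2 a (b.trans hrs)⟩

/-- The values `p₁ = p₂ = 1`, `q₄₁ = 1`, `q₄₂ = -1`, `q₅₁ = q₅₂ = -1/2` satisfy the three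
reduced equations, and in particular (taking `q₁ᵢ = q₂ = q₃ᵢ = 0`) the Softmax–Softmax
polynomial system of order `r = 3` with `m = 2` blocks admits a non-trivial solution for
every `d ≥ 1`, so `r^SS(2) > 3`. -/
theorem rSS_two_gt_three :
    let p : Fin 2 → ℝ := ![1, 1]
    let q4 : Fin 2 → ℝ := ![1, -1]
    let q5 : Fin 2 → ℝ := ![-(1/2), -(1/2)]
    (∑ i : Fin 2, p i ^ 2 * q4 i = 0) ∧
    (∑ i : Fin 2, p i ^ 2 * ((1/2) * q4 i ^ 2 + q5 i) = 0) ∧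
    (∑ i : Fin 2, p i ^ 2 * ((1/6) * q4 i ^ 3 + q4 i * q5 i) = 0) ∧
    (∀ d : ℕ, 1 ≤ d → ssHasNontrivial 2 d 3 ∧ 3 < rSS 2 d) := by
  refine ⟨?_, ?_, ?_, fun d _ => ⟨hasNontrivial_three d, ?_⟩⟩
  · simp
  · simp
  · simp
    norm_num
  · by_contra hlt
    have hmem : rSS 2 d ∈ {r : ℕ | ¬ ssHasNontrivial 2 d r} :=
      Nat.sInf_mem ⟨4, not_hasNontrivial_four d⟩
    exact hmem (ssHasNontrivial_mono (by omega) (hasNontrivial_three d))
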